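/- arXiv:2508.15971 — 4 statements merged into one kernel-verified Lean document; each statement's English description precedes it below -/
import Mathlib

section
/- Let p be a prime. There is a unique continuous homomorphism e_p from the additive topological group Ẑ := ∏_ℓ ℤ_ℓ (product of the rings of ℓ-adic integers over all primes ℓ) to the topological group Ẑ_{(p)}ˣ := ∏_{q≠p} ℤ_qˣ such that e_p(n) = u_pⁿ for every integer n, where u_p ∈ Ẑ_{(p)}ˣ is the element all of whose components equal p. Moreover e_p is injective; hence e_p is an isomorphism of topological groups from Ẑ onto the closure of the cyclic subgroup generated by u_p, and for every positive integer f one has e_p(f·Ẑ) ∩ { u_pⁿ : n ∈ ℤ } = { u_p^{fn} : n ∈ ℤ }. -/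
noncomputable section

/-- The multiplicative group of positive real numbers `ℝ₊`. -/
abbrev Rpos : Type := {x : ℝ // (0 : ℝ) < x}

/-- The relation on `G × ℝ₊` given by the `ℤ`-action `n • (h, s) = (gⁿ * h, cⁿ * s)`;
its quotient `Quot (torusRel g c)` is the mapping torus of multiplication by `g`. -/
def torusRel {G : Type*} [Group G] (g : G) (c : Rpos) (x y : G × Rpos) : Prop :=
  ∃ n : ℤ, y = (g ^ n * x.1, c ^ n * x.2)

/-- The mapping torus of multiplication by `g`, with scaling constant `c`. -/
abbrev MappingTorus {G : Type*} [Group G] (g : G) (c : Rpos) : Type _ :=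
  Quot (torusRel g c)

/-- The `ℝ₊`-action on the mapping torus: `t • [h, s] = [h, t * s]`. -/
def torusAct {G : Type*} [Group G] (g : G) (c : Rpos) (t : Rpos) :
    MappingTorus g c → MappingTorus g c :=
  Quot.map (fun x => (x.1, t * x.2)) (by
    rintro x y ⟨n, rfl⟩
    exact ⟨n, by rw [Prod.ext_iff]; exact ⟨rfl, mul_left_comm _ _ _⟩⟩)

instance (p : Nat.Primes) : Fact (Nat.Prime (p : ℕ)) := ⟨p.2⟩

/-- For primes `q ≠ p`, the rational prime `p` is a unit in `ℤ_q`. -/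
theorem pIsUnit (p q : Nat.Primes) (hq : q ≠ p) : IsUnit ((p : ℕ) : ℤ_[(q : ℕ)]) := by
  rw [PadicInt.isUnit_iff]
  refine le_antisymm (PadicInt.norm_le_one _) (not_lt.mp fun hlt => hq ?_)
  have h1 : ‖(((p : ℕ) : ℤ) : ℤ_[(q : ℕ)])‖ < 1 := by exact_mod_cast hlt
  have h2 : ((q : ℕ) : ℤ) ∣ ((p : ℕ) : ℤ) := (PadicInt.norm_int_lt_one_iff_dvd _).mp h1
  exact Nat.Primes.coe_nat_injective
    ((Nat.prime_dvd_prime_iff_eq q.2 p.2).mp (Int.natCast_dvd_natCast.mp h2))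

/-- `Ẑ_{(p)}ˣ = ∏_{q ≠ p} ℤ_qˣ`, the product over all primes `q ≠ p` of the unit groups of the
rings of `q`-adic integers. -/
abbrev PUnits (p : Nat.Primes) : Type :=
  ∀ q : {q : Nat.Primes // q ≠ p}, ℤ_[((q : Nat.Primes) : ℕ)]ˣ

/-- The element `u_p ∈ Ẑ_{(p)}ˣ` all of whose components equal `p`. -/
def uP (p : Nat.Primes) : PUnits p := fun q => (pIsUnit p q.1 q.2).unit

/-- The prime `p` as a positive real number. -/
def pPos (p : Nat.Primes) : Rpos := ⟨((p : ℕ) : ℝ), by exact_mod_cast p.2.pos⟩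

/-- `Ẑ = ∏_ℓ ℤ_ℓ`, the product of the rings of `ℓ`-adic integers over all primes. -/
abbrev ZHat : Type := ∀ q : Nat.Primes, ℤ_[(q : ℕ)]

/-- Two homomorphisms `i`, `j` from a group to compact Hausdorff groups whose joint closure is
the graph of a bijection induce a closed embedding extending `j` along `i`. -/
theorem exists_isClosedEmbedding_of_closure_prod {G A B : Type*} [AddGroup G]
    [AddGroup A] [TopologicalSpace A] [IsTopologicalAddGroup A] [CompactSpace A] [T2Space A]
    [AddGroup B] [TopologicalSpace B] [IsTopologicalAddGroup B] [CompactSpace B] [T2Space B]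
    (i : G →+ A) (j : G →+ B) (hi : DenseRange i)
    (hB : ∀ y : B, ((0 : A), y) ∈ closure (Set.range fun g => (i g, j g)) → y = 0)
    (hA : ∀ x : A, (x, (0 : B)) ∈ closure (Set.range fun g => (i g, j g)) → x = 0) :
    ∃ e : A →+ B, Topology.IsClosedEmbedding e ∧ ∀ g, e (i g) = j g := by
  let Γ : AddSubgroup (A × B) := (i.prod j).range.topologicalClosure
  have hcl : IsClosed (Γ : Set (A × B)) := AddSubgroup.isClosed_topologicalClosure _
  have hmem : ∀ z, z ∈ Γ ↔ z ∈ closure (Set.range fun g => (i g, j g)) := fun z => Iff.rfl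
  have hg : ∀ g, (i g, j g) ∈ Γ := fun g => (hmem _).2 (subset_closure ⟨g, rfl⟩)
  have : CompactSpace Γ := isCompact_iff_compactSpace.1 hcl.isCompact
  let f₁ : Γ →+ A := (AddMonoidHom.fst A B).comp Γ.subtype
  let f₂ : Γ →+ B := (AddMonoidHom.snd A B).comp Γ.subtype
  have c₁ : Continuous f₁ := continuous_fst.comp continuous_subtype_val
  have c₂ : Continuous f₂ := continuous_snd.comp continuous_subtype_val
  have inj₁ : Function.Injective f₁ := by
    rw [injective_iff_map_eq_zero]
    rintro ⟨⟨x, y⟩, h⟩ (rfl : x = 0)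
    obtain rfl := hB y ((hmem _).1 h)
    rfl
  have inj₂ : Function.Injective f₂ := by
    rw [injective_iff_map_eq_zero]
    rintro ⟨⟨x, y⟩, h⟩ (rfl : y = 0)
    obtain rfl := hA x ((hmem _).1 h)
    rfl
  have surj₁ : Function.Surjective f₁ := by
    have hd : DenseRange f₁ := hi.mono (by rintro _ ⟨g, rfl⟩; exact ⟨⟨_, hg g⟩, rfl⟩)
    exact Set.range_eq_univ.1 ((isCompact_range c₁).isClosed.closure_eq ▸ hd.closure_range)
  let E : Γ ≃+ A := AddEquiv.ofBijective f₁ ⟨inj₁, surj₁⟩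
  let H : Γ ≃ₜ A := Continuous.homeoOfEquivCompactToT2 (f := E.toEquiv) c₁
  refine ⟨f₂.comp E.symm.toAddMonoidHom,
    (c₂.isClosedEmbedding inj₂).comp H.symm.isClosedEmbedding, fun g => ?_⟩
  have : E.symm (i g) = ⟨_, hg g⟩ := E.symm_apply_eq.2 rfl
  change f₂ (E.symm (i g)) = j g
  rw [this]
  rfl

/-- The integers are dense in `Ẑ`. -/
theorem denseRange_intCast_ZHat : DenseRange ((↑) : ℤ → ZHat) := by
  intro x
  rw [mem_closure_iff]
  intro s hs hx
  obtain ⟨I, u, hu, hus⟩ := isOpen_pi_iff.1 hs x hx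
  have hk : ∀ q : Nat.Primes, ∃ k : ℕ, q ∈ I →
      ∀ z : ℤ_[(q : ℕ)], ‖z - x q‖ ≤ ((q : ℕ) : ℝ) ^ (-(k : ℤ)) → z ∈ u q := by
    intro q
    by_cases hq : q ∈ I
    · obtain ⟨ε, hε, hb⟩ := Metric.isOpen_iff.1 (hu q hq).1 _ (hu q hq).2
      obtain ⟨k, hk⟩ := PadicInt.exists_pow_neg_lt (q : ℕ) hε
      exact ⟨k, fun _ z hz => hb (by rw [Metric.mem_ball, dist_eq_norm]; exact hz.trans_lt hk)⟩
    · exact ⟨0, fun h => absurd h hq⟩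
  choose k hk using hk
  obtain ⟨n, hn⟩ := Nat.chineseRemainderOfFinset (fun q : Nat.Primes => (x q).appr (k q))
    (fun q => (q : ℕ) ^ k q) I (fun q _ => pow_ne_zero _ q.2.ne_zero)
    (fun q _ r _ hqr => Nat.coprime_pow_primes _ _ q.2 r.2
      fun h => hqr (Nat.Primes.coe_nat_injective h))
  refine ⟨((n : ℤ) : ZHat), hus fun q hq => hk q hq _ ?_, n, rfl⟩
  rw [PadicInt.norm_le_pow_iff_mem_span_pow]
  have h₁ := PadicInt.appr_spec (k q) (x q)
  have h₂ : (((n : ℤ) : ℤ_[(q : ℕ)]) - ((x q).appr (k q) : ℤ_[(q : ℕ)])) ∈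
      Ideal.span {((q : ℕ) : ℤ_[(q : ℕ)]) ^ k q} := by
    rw [Ideal.mem_span_singleton]
    have h := (Nat.modEq_iff_dvd.1 (hn q hq).symm)
    have h' := map_dvd (Int.castRingHom ℤ_[(q : ℕ)]) h
    simpa using h'
  have h₃ := sub_mem h₂ h₁
  simpa using h₃

/-- An integer is divisible by `N` if it is so in `ℤ_q` for every prime `q` dividing `N`. -/
theorem natCast_dvd_of_forall_norm_le {N : ℕ} {k : ℤ}
    (h : ∀ q : Nat.Primes, (q : ℕ) ∣ N → ‖(k : ℤ_[(q : ℕ)])‖ ≤ ‖(N : ℤ_[(q : ℕ)])‖) :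
    (N : ℤ) ∣ k := by
  rw [Int.natCast_dvd, Nat.dvd_iff_prime_pow_dvd_dvd]
  intro q j hq hj
  rcases Nat.eq_zero_or_pos j with rfl | hj0
  · simp
  have : Fact q.Prime := ⟨hq⟩
  have h₁ := h ⟨q, hq⟩ ((dvd_pow_self q hj0.ne').trans hj)
  have h₂ : ‖((N : ℤ) : ℤ_[q])‖ ≤ (q : ℝ) ^ (-(j : ℤ)) :=
    PadicInt.norm_int_le_pow_iff_dvd.2 (by exact_mod_cast hj)
  rw [Int.cast_natCast] at h₂
  have h₃ := PadicInt.norm_int_le_pow_iff_dvd.1 (h₁.trans h₂)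
  rw [← Int.natCast_dvd]
  exact_mod_cast h₃

theorem PadicInt.norm_units_zpow_sub_one {q : ℕ} [Fact q.Prime] (u : ℤ_[q]ˣ) (n : ℤ) :
    ‖((u ^ n : ℤ_[q]ˣ) : ℤ_[q]) - 1‖ = ‖(u : ℤ_[q]) ^ n.natAbs - 1‖ := by
  obtain ⟨m, rfl | rfl⟩ := n.eq_nat_or_neg
  · simp
  · have h : (((u ^ (-(m : ℤ)) : ℤ_[q]ˣ)) : ℤ_[q]) - 1 =
        -(((u ^ (-(m : ℤ)) : ℤ_[q]ˣ)) : ℤ_[q]) * ((u : ℤ_[q]) ^ m - 1) := by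
      have : (((u ^ (-(m : ℤ)) : ℤ_[q]ˣ)) : ℤ_[q]) * (u : ℤ_[q]) ^ m = 1 := by
        rw [← Units.val_pow_eq_pow_val, ← Units.val_mul]
        simp
      linear_combination this
    rw [h, norm_mul, norm_neg, PadicInt.norm_units]
    simp

theorem norm_uP_zpow_sub_one (p : Nat.Primes) (q : {q : Nat.Primes // q ≠ p}) (n : ℤ) :
    ‖(((uP p ^ n) q : ℤ_[((q : Nat.Primes) : ℕ)]ˣ) : ℤ_[((q : Nat.Primes) : ℕ)]) - 1‖ =
      ‖((((p : ℕ) : ℤ) ^ n.natAbs - 1 : ℤ) : ℤ_[((q : Nat.Primes) : ℕ)])‖ := by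
  rw [Pi.pow_apply, PadicInt.norm_units_zpow_sub_one]
  simp [uP]

theorem dvd_of_pow_sub_one_dvd_pow_sub_one {a m n : ℕ} (ha : 1 < a) (h : a ^ m - 1 ∣ a ^ n - 1) :
    m ∣ n := by
  have h₁ := Nat.pow_sub_one_gcd_pow_sub_one a m n
  rw [Nat.gcd_eq_left h] at h₁
  have h₂ : a ^ m.gcd n = a ^ m := by
    have := Nat.one_le_pow m a (by omega)
    have := Nat.one_le_pow (m.gcd n) a (by omega)
    omega
  exact Nat.gcd_eq_left_iff_dvd.1 (Nat.pow_right_injective ha h₂)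

theorem finite_primes_dvd {N : ℕ} (hN : N ≠ 0) : {q : Nat.Primes | (q : ℕ) ∣ N}.Finite :=
  (N.divisors.finite_toSet.preimage Nat.Primes.coe_nat_injective.injOn).subset
    fun q (hq : (q : ℕ) ∣ N) => by simp [hq, hN]

theorem PadicInt.isClopen_norm_sub_le {q : ℕ} [Fact q.Prime] (a : ℤ_[q]) {c : ℝ} (hc : c ≠ 0) :
    IsClopen {z : ℤ_[q] | ‖z - a‖ ≤ c} := by
  simpa [Metric.closedBall, dist_eq_norm] using IsUltrametricDist.isClopen_closedBall a hc

theorem PadicInt.eq_zero_of_forall_norm_le {q : ℕ} [Fact q.Prime] {z : ℤ_[q]}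
    (h : ∀ k : ℕ, ‖z‖ ≤ (q : ℝ) ^ (-(k : ℤ))) : z = 0 := by
  by_contra hz
  obtain ⟨k, hk⟩ := PadicInt.exists_pow_neg_lt q (norm_pos_iff.2 hz)
  exact (h k).not_gt hk

/-- The closure of `{(n, u_pⁿ)}` meets `0 × Ẑ_{(p)}ˣ` trivially. -/
theorem eq_zero_of_mem_closure_left (p : Nat.Primes) (y : Additive (PUnits p))
    (hy : ((0 : ZHat), y) ∈
      closure (Set.range fun n : ℤ => ((n : ZHat), Additive.ofMul (uP p ^ n)))) : y = 0 := by
  suffices ∀ q, (Additive.toMul y) q = 1 from congrArg Additive.ofMul (funext this)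
  intro q
  rw [← Units.val_inj, ← sub_eq_zero]
  refine PadicInt.eq_zero_of_forall_norm_le fun k => ?_
  set N := ((q : Nat.Primes) : ℕ) ^ k with hN
  have hcop : Nat.Coprime (p : ℕ) N := Nat.Coprime.pow_right _
    ((Nat.coprime_primes p.2 q.1.2).2 fun h => q.2 (Nat.Primes.coe_nat_injective h.symm))
  have hm : N.totient ≠ 0 :=
    (Nat.totient_pos.2 (pow_pos q.1.2.pos k)).ne'
  let S : Set (ZHat × Additive (PUnits p)) := {z | (∀ r ∈ {r : Nat.Primes | (r : ℕ) ∣ N.totient},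
      ‖z.1 r - 0‖ ≤ ‖(N.totient : ℤ_[(r : ℕ)])‖) →
    ‖((Additive.toMul z.2 q : ℤ_[((q : Nat.Primes) : ℕ)]ˣ) : ℤ_[((q : Nat.Primes) : ℕ)]) - 1‖ ≤
      (((q : Nat.Primes) : ℕ) : ℝ) ^ (-(k : ℤ))}
  have hS : IsClosed S := by
    refine isClosed_imp ?_ ?_
    · simp only [Set.ofPred_forall]
      refine (finite_primes_dvd hm).isOpen_biInter fun r _ => ?_
      have ho : IsOpen {z : ℤ_[(r : ℕ)] | ‖z - 0‖ ≤ ‖(N.totient : ℤ_[(r : ℕ)])‖} :=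
        (PadicInt.isClopen_norm_sub_le 0 (norm_ne_zero_iff.2 (Nat.cast_ne_zero.2 hm))).isOpen
      have hc : Continuous fun z : ZHat × Additive (PUnits p) => z.1 r :=
        (continuous_apply r).comp continuous_fst
      exact ho.preimage hc
    · refine isClosed_le (Continuous.norm (Continuous.sub ?_ continuous_const)) continuous_const
      exact Units.continuous_val.comp ((continuous_apply q).comp
        (continuous_toMul.comp continuous_snd))
  have hsub : (Set.range fun n : ℤ => ((n : ZHat), Additive.ofMul (uP p ^ n))) ⊆ S := by
    rintro _ ⟨n, rfl⟩ h
    have hdvd : (N.totient : ℤ) ∣ n := natCast_dvd_of_forall_norm_le fun r hr => by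
      simpa using h r hr
    refine (norm_uP_zpow_sub_one p q n).trans_le ?_
    rw [PadicInt.norm_int_le_pow_iff_dvd]
    have h₁ : (p : ℕ) ^ N.totient ≡ 1 [MOD N] := Nat.ModEq.pow_totient hcop
    have h₂ := (Nat.modEq_iff_dvd.1 h₁.symm)
    push_cast at h₂
    obtain ⟨c, hc⟩ := Int.natCast_dvd.1 hdvd
    rw [hc]
    have h₃ := h₂.trans (pow_one_sub_dvd_pow_mul_sub_one (((p : ℕ) : ℤ)) N.totient c)
    simpa [hN] using h₃
  exact closure_minimal hsub hS hy fun r _ => by simp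

/-- The closure of `{(n, u_pⁿ)}` meets `Ẑ × 1` trivially. -/
theorem eq_zero_of_mem_closure_right (p : Nat.Primes) (x : ZHat)
    (hx : (x, (0 : Additive (PUnits p))) ∈
      closure (Set.range fun n : ℤ => ((n : ZHat), Additive.ofMul (uP p ^ n)))) : x = 0 := by
  funext l
  refine PadicInt.eq_zero_of_forall_norm_le fun k => ?_
  set m := (l : ℕ) ^ k with hm
  have hm0 : m ≠ 0 := pow_ne_zero _ l.2.ne_zero
  have hlt : 1 < (p : ℕ) ^ m := Nat.one_lt_pow hm0 p.2.one_lt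
  set N := (p : ℕ) ^ m - 1 with hN
  have hN0 : N ≠ 0 := by omega
  have hpN : ¬ (p : ℕ) ∣ N := fun h => by
    have h₁ : (p : ℕ) ∣ N + 1 := by
      rw [hN, Nat.sub_add_cancel hlt.le]; exact dvd_pow_self _ hm0
    exact p.2.one_lt.ne' (Nat.dvd_one.1 ((Nat.dvd_add_right h).1 h₁))
  let T : Set {q : Nat.Primes // q ≠ p} := {r | ((r : Nat.Primes) : ℕ) ∣ N}
  have hT : T.Finite :=
    Set.Finite.preimage (f := Subtype.val) Subtype.val_injective.injOn (finite_primes_dvd hN0)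
  let S : Set (ZHat × Additive (PUnits p)) := {z | (∀ q ∈ T,
      ‖((Additive.toMul z.2 q : ℤ_[((q : Nat.Primes) : ℕ)]ˣ) : ℤ_[((q : Nat.Primes) : ℕ)]) - 1‖ ≤
        ‖(N : ℤ_[((q : Nat.Primes) : ℕ)])‖) →
    ‖z.1 l‖ ≤ ((l : ℕ) : ℝ) ^ (-(k : ℤ))}
  have hS : IsClosed S := by
    refine isClosed_imp ?_ ?_
    · simp only [Set.ofPred_forall]
      refine hT.isOpen_biInter fun q _ => ?_
      exact (PadicInt.isClopen_norm_sub_le 1 (norm_ne_zero_iff.2 (Nat.cast_ne_zero.2 hN0))).isOpen.preimage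
        (Units.continuous_val.comp ((continuous_apply q).comp
          (continuous_toMul.comp continuous_snd)))
    · exact isClosed_le ((continuous_apply l).comp continuous_fst).norm continuous_const
  have hsub : (Set.range fun n : ℤ => ((n : ZHat), Additive.ofMul (uP p ^ n))) ⊆ S := by
    rintro _ ⟨n, rfl⟩ h
    have hdvd : (N : ℤ) ∣ ((p : ℕ) : ℤ) ^ n.natAbs - 1 :=
      natCast_dvd_of_forall_norm_le fun q hq => by
        have hqp : q ≠ p := fun e => hpN (e ▸ hq)
        exact (norm_uP_zpow_sub_one p ⟨q, hqp⟩ n).symm.trans_le (h ⟨q, hqp⟩ hq)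
    have h₁ : N ∣ (p : ℕ) ^ n.natAbs - 1 := by
      rw [← Int.natCast_dvd_natCast,
        Nat.cast_sub (m := 1) (n := (p : ℕ) ^ n.natAbs) (Nat.one_le_pow _ _ p.2.pos)]
      exact_mod_cast hdvd
    have h₂ : m ∣ n.natAbs := dvd_of_pow_sub_one_dvd_pow_sub_one p.2.one_lt h₁
    have h₃ : ((l : ℕ) : ℤ) ^ k ∣ n := by
      have := Int.natCast_dvd.2 h₂
      rw [hm] at this
      exact_mod_cast this
    exact PadicInt.norm_int_le_pow_iff_dvd.2 h₃
  exact closure_minimal hsub hS hx fun q _ => by simp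

/-- there is a unique continuous homomorphism `e_p` from the additive group `Ẑ`
to `Ẑ_{(p)}ˣ` with `e_p n = u_pⁿ` for all integers `n`; it is injective, a homeomorphism onto
the closure of the cyclic subgroup generated by `u_p`, and
`e_p(fẐ) ∩ {u_pⁿ : n ∈ ℤ} = {u_p^{fn} : n ∈ ℤ}` for every positive integer `f`. -/
theorem statement5 (p : Nat.Primes) :
    ∃ e : ZHat →+ Additive (PUnits p),
      (Continuous e ∧ ∀ n : ℤ, e ((n : ZHat)) = Additive.ofMul (uP p ^ n)) ∧
      (∀ e' : ZHat →+ Additive (PUnits p),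
        (Continuous e' ∧ ∀ n : ℤ, e' ((n : ZHat)) = Additive.ofMul (uP p ^ n)) → e' = e) ∧
      Function.Injective e ∧
      Topology.IsInducing (⇑e) ∧
      Set.range (fun x : ZHat => Additive.toMul (e x)) =
        closure ((Subgroup.zpowers (uP p) : Subgroup (PUnits p)) : Set (PUnits p)) ∧
      ∀ f : ℕ, 0 < f →
        {y : PUnits p | ∃ x : ZHat, y = Additive.toMul (e ((f : ZHat) * x))} ∩
            {y : PUnits p | ∃ n : ℤ, y = uP p ^ n} =
          {y : PUnits p | ∃ n : ℤ, y = uP p ^ ((f : ℤ) * n)} := by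
  have : T2Space (Additive (PUnits p)) := inferInstanceAs (T2Space (PUnits p))
  obtain ⟨e, he, hn⟩ := exists_isClosedEmbedding_of_closure_prod
    (Int.castAddHom ZHat) (zmultiplesHom (Additive (PUnits p)) (Additive.ofMul (uP p)))
    denseRange_intCast_ZHat (eq_zero_of_mem_closure_left p) (eq_zero_of_mem_closure_right p)
  replace hn : ∀ n : ℤ, e (n : ZHat) = Additive.ofMul (uP p ^ n) := hn
  refine ⟨e, ⟨he.continuous, hn⟩, ?_, he.injective, he.isInducing, ?_, ?_⟩
  · rintro e' ⟨hc, hn'⟩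
    refine DFunLike.coe_injective (denseRange_intCast_ZHat.equalizer hc he.continuous ?_)
    funext n
    exact (hn' n).trans (hn n).symm
  · apply subset_antisymm
    · rintro _ ⟨x, rfl⟩
      refine (map_mem_closure (s := Set.range ((↑) : ℤ → ZHat))
        (continuous_toMul.comp he.continuous) (denseRange_intCast_ZHat x) ?_)
      rintro _ ⟨n, rfl⟩
      exact ⟨n, (congrArg Additive.toMul (hn n)).symm⟩
    · refine closure_minimal ?_ (isCompact_range (continuous_toMul.comp he.continuous)).isClosed
      rintro _ ⟨n, rfl⟩
      exact ⟨n, congrArg Additive.toMul (hn n)⟩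
  · intro f hf
    ext y
    constructor
    · rintro ⟨⟨x, hx⟩, n, rfl⟩
      have hfx : (n : ZHat) = (f : ZHat) * x := he.injective ((hn n).trans hx)
      have hdvd : (f : ℤ) ∣ n := natCast_dvd_of_forall_norm_le fun q _ => by
        have h : (n : ℤ_[(q : ℕ)]) = (f : ℤ_[(q : ℕ)]) * x q := congrFun hfx q
        rw [h, norm_mul]
        exact mul_le_of_le_one_right (norm_nonneg _) (PadicInt.norm_le_one _)
      obtain ⟨c, rfl⟩ := hdvd
      exact ⟨c, rfl⟩
    · rintro ⟨n, rfl⟩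
      refine ⟨⟨(n : ZHat), ?_⟩, _, rfl⟩
      have h := hn ((f : ℤ) * n)
      push_cast at h
      rw [h]
      rfl
end
end

section
/- Let p be a prime, P := ∏_{q≠p} ℤ_qˣ, and u_p ∈ P the element all of whose components equal p. Let T be the quotient of P × ℝ₊ by the ℤ-action n·(a, s) := (u_pⁿ·a, pⁿ·s), with quotient topology, and let ℝ₊ act on T by t·[a, s] := [a, t·s]. Then for every a ∈ P the map ℝ₊ → T, t ↦ [a, t], is continuous and injective, and its image is exactly the ℝ₊-orbit of [a, 1]. Moreover, [a, 1] and [b, 1] lie in the same ℝ₊-orbit if and only if b = u_pⁿ·a for some n ∈ ℤ; consequently the ℝ₊-orbits of T are in natural bijection with the quotient of P by the cyclic subgroup generated by u_p, and no ℝ₊-orbit of T is periodic. -/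
noncomputable section

theorem torusRel_equivalence {G : Type*} [Group G] (g : G) (c : Rpos) :
    Equivalence (torusRel g c) where
  refl x := ⟨0, by simp⟩
  symm := by
    rintro x y ⟨n, rfl⟩
    exact ⟨-n, by simp⟩
  trans := by
    rintro x y z ⟨n, rfl⟩ ⟨m, rfl⟩
    exact ⟨m + n, by simp only [zpow_add, mul_assoc]⟩

theorem torus_mk_eq_iff {G : Type*} [Group G] {g : G} {c : Rpos} {x y : G × Rpos} :
    Quot.mk (torusRel g c) x = Quot.mk (torusRel g c) y ↔ torusRel g c x y :=
  (torusRel_equivalence g c).quot_mk_eq_iff x y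

theorem torusAct_mk {G : Type*} [Group G] (g : G) (c t : Rpos) (a : G) (s : Rpos) :
    torusAct g c t (Quot.mk _ (a, s)) = Quot.mk _ (a, t * s) :=
  rfl

theorem torus_mk_injective {G : Type*} [Group G] {g : G} (c : Rpos)
    (hg : ∀ n : ℤ, g ^ n = 1 → n = 0) (a : G) :
    Function.Injective (fun t : Rpos => Quot.mk (torusRel g c) (a, t)) := by
  intro s t h
  obtain ⟨n, hn⟩ := torus_mk_eq_iff.mp h
  obtain ⟨h1, h2⟩ := Prod.ext_iff.mp hn
  have hn0 : n = 0 := hg n (right_eq_mul.mp h1)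
  subst hn0
  simpa using h2.symm

theorem exists_torusAct_mk_eq_iff {G : Type*} [Group G] (g : G) (c : Rpos) (a b : G) :
    (∃ t : Rpos, torusAct g c t (Quot.mk _ (a, 1)) = Quot.mk _ (b, 1)) ↔
      ∃ n : ℤ, b = g ^ n * a := by
  constructor
  · rintro ⟨t, ht⟩
    obtain ⟨n, hn⟩ := torus_mk_eq_iff.mp ht
    exact ⟨n, congrArg Prod.fst hn⟩
  · rintro ⟨n, rfl⟩
    refine ⟨(c ^ n)⁻¹, torus_mk_eq_iff.mpr ⟨n, ?_⟩⟩
    simp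

/-- The orbits of the `ℝ₊`-action on the mapping torus of multiplication by `g` on a commutative
group correspond to the cosets of the cyclic subgroup generated by `g`. -/
def torusOrbitEquiv {G : Type*} [CommGroup G] (g : G) (c : Rpos) :
    Quot (fun x y : MappingTorus g c => ∃ t : Rpos, y = torusAct g c t x) ≃
      G ⧸ Subgroup.zpowers g where
  toFun := Quot.lift
    (Quot.lift (fun x => (QuotientGroup.mk x.1 : G ⧸ Subgroup.zpowers g)) (by
      rintro x y ⟨n, rfl⟩
      exact QuotientGroup.eq.mpr ⟨n, by simp [mul_comm]⟩))
    (by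
      rintro ⟨x⟩ y ⟨t, rfl⟩
      rfl)
  invFun := Quotient.lift (fun a => Quot.mk _ (Quot.mk _ (a, 1))) (by
    intro a b hab
    obtain ⟨n, hn⟩ := QuotientGroup.leftRel_apply.mp hab
    obtain ⟨t, ht⟩ := (exists_torusAct_mk_eq_iff g c a b).mpr
      ⟨n, by simpa [mul_comm] using (eq_inv_mul_iff_mul_eq.mp hn).symm⟩
    exact Quot.sound ⟨t, ht.symm⟩)
  left_inv := by
    rintro ⟨⟨a, s⟩⟩
    refine Quot.sound ⟨s, ?_⟩
    rw [torusAct_mk, mul_one]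
  right_inv := by
    rintro ⟨a⟩
    rfl

theorem uP_zpow_eq_one (p : Nat.Primes) (n : ℤ) (h : uP p ^ n = 1) : n = 0 := by
  obtain ⟨q, hq⟩ : ∃ q : Nat.Primes, q ≠ p := exists_ne p
  have h1 : (pIsUnit p q hq).unit ^ n = 1 := congrFun h ⟨q, hq⟩
  have key : ∀ m : ℕ, (pIsUnit p q hq).unit ^ m = 1 → m = 0 := by
    intro m hm
    have h2 : ((((p : ℕ) ^ m : ℕ)) : ℤ_[(q : ℕ)]) = ((1 : ℕ) : ℤ_[(q : ℕ)]) := by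
      simpa using congrArg Units.val hm
    exact (Nat.pow_eq_one.mp (Nat.cast_injective h2)).resolve_left p.2.ne_one
  obtain ⟨m, rfl | rfl⟩ := n.eq_nat_or_neg
  · simpa using key m (by simpa using h1)
  · simpa using key m (by simpa using h1)

/-- structure of the `ℝ₊`-orbits of the mapping torus of multiplication by `u_p`
on `Ẑ_{(p)}ˣ`: each orbit is an injective continuous image of `ℝ₊`, the orbits are in natural
bijection with `Ẑ_{(p)}ˣ` modulo the cyclic subgroup generated by `u_p`, and no orbit is
periodic. -/
theorem statement6 (p : Nat.Primes) :
    (∀ a : PUnits p,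
      Continuous (fun t : Rpos => Quot.mk (torusRel (uP p) (pPos p)) (a, t)) ∧
      Function.Injective (fun t : Rpos => Quot.mk (torusRel (uP p) (pPos p)) (a, t)) ∧
      Set.range (fun t : Rpos => Quot.mk (torusRel (uP p) (pPos p)) (a, t)) =
        {y | ∃ t : Rpos, y = torusAct (uP p) (pPos p) t (Quot.mk _ (a, 1))}) ∧
    (∀ a b : PUnits p,
      (∃ t : Rpos, torusAct (uP p) (pPos p) t (Quot.mk _ (a, 1)) = Quot.mk _ (b, 1)) ↔
        ∃ n : ℤ, b = uP p ^ n * a) ∧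
    (∃ B : Quot (fun x y : MappingTorus (uP p) (pPos p) =>
          ∃ t : Rpos, y = torusAct (uP p) (pPos p) t x) ≃
          (PUnits p ⧸ Subgroup.zpowers (uP p)),
      ∀ a : PUnits p, B (Quot.mk _ (Quot.mk _ (a, 1))) = QuotientGroup.mk a) ∧
    (∀ (x : MappingTorus (uP p) (pPos p)) (t : Rpos),
      torusAct (uP p) (pPos p) t x = x → t = 1) := by
  have hg := uP_zpow_eq_one p
  refine ⟨fun a => ⟨continuous_quot_mk.comp (by fun_prop), torus_mk_injective _ hg a, ?_⟩,
    exists_torusAct_mk_eq_iff _ _, ⟨torusOrbitEquiv _ _, fun a => rfl⟩, ?_⟩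
  · ext y
    simp only [Set.mem_range, Set.mem_ofPred_eq, torusAct_mk, mul_one, eq_comm]
  · rintro ⟨a, s⟩ t h
    exact mul_eq_right.mp (torus_mk_injective _ hg a h)
end
end

section
/- Let G be a finite abelian group with the discrete topology, g ∈ G an element of order f, r := |G|/f, and p > 1 a real number. Let T be the quotient of G × ℝ₊ by the ℤ-action n·(h, s) := (gⁿ·h, pⁿ·s), with the quotient topology. Then T has exactly r connected components; each connected component is homeomorphic to the circle ℝ₊/p^{fℤ}; and the map T → ℝ₊/p^ℤ, [h, s] ↦ class of s, is well defined and continuous and restricts on each connected component to a cyclic covering of degree f. -/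
noncomputable section

open Set Topology

section MappingTorus

variable {G : Type*} [Group G] (g : G) (c : Rpos)

theorem equivalence_torusRel : Equivalence (torusRel g c) where
  refl x := ⟨0, by simp⟩
  symm := by
    rintro x y ⟨n, rfl⟩
    exact ⟨-n, by simp⟩
  trans := by
    rintro x y z ⟨n, rfl⟩ ⟨m, rfl⟩
    exact ⟨m + n, by simp [zpow_add, mul_assoc]⟩

theorem MappingTorus.mk_eq_mk_iff (x y : G × Rpos) :
    (Quot.mk _ x : MappingTorus g c) = Quot.mk _ y ↔ torusRel g c x y :=
  (equivalence_torusRel g c).quot_mk_eq_iff x y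

theorem continuous_rpos_mul_left (t : Rpos) : Continuous fun s : Rpos => t * s :=
  (continuous_const.mul continuous_subtype_val).subtype_mk _

/-- The projection of the mapping torus to the circle `ℝ₊/c^ℤ`. -/
def MappingTorus.proj : MappingTorus g c → Rpos ⧸ Subgroup.zpowers c :=
  Quot.lift (fun x => QuotientGroup.mk x.2) (by
    rintro x y ⟨n, rfl⟩
    refine QuotientGroup.eq.2 ⟨n, ?_⟩
    simp [mul_comm])

theorem MappingTorus.continuous_proj [TopologicalSpace G] :
    Continuous (MappingTorus.proj g c) :=
  continuous_quot_lift _ (continuous_quotient_mk'.comp continuous_snd)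

/-- The curve `s ↦ [h, s]` in the mapping torus. -/
def MappingTorus.curve (h : G) (s : Rpos) : MappingTorus g c := Quot.mk _ (h, s)

variable {g c} in
theorem MappingTorus.curve_eq_curve_iff (h : G) (s t : Rpos) :
    MappingTorus.curve g c h s = MappingTorus.curve g c h t ↔
      (QuotientGroup.mk s : Rpos ⧸ Subgroup.zpowers (c ^ orderOf g)) = QuotientGroup.mk t := by
  rw [MappingTorus.curve, MappingTorus.curve, MappingTorus.mk_eq_mk_iff, QuotientGroup.eq]
  constructor
  · rintro ⟨n, hn⟩
    obtain ⟨h1, rfl⟩ := Prod.ext_iff.1 hn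
    have h2 : g ^ n = 1 := by simpa using h1.symm
    obtain ⟨k, rfl⟩ := orderOf_dvd_iff_zpow_eq_one.2 h2
    refine ⟨k, ?_⟩
    simp only [zpow_mul, zpow_natCast]
    rw [mul_comm _ s, inv_mul_cancel_left]
  · rintro ⟨k, hk⟩
    refine ⟨orderOf g * k, ?_⟩
    have ht : t = (c ^ orderOf g) ^ k * s := by
      simp only at hk
      rw [hk, mul_comm, mul_inv_cancel_left]
    simp [zpow_mul, pow_orderOf_eq_one, ht]

theorem MappingTorus.continuous_curve [TopologicalSpace G] (h : G) :
    Continuous (MappingTorus.curve g c h) :=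
  continuous_quot_mk.comp (Continuous.prodMk_right h)

section Topology

variable [TopologicalSpace G] [DiscreteTopology G]

theorem MappingTorus.isOpenMap_mk :
    IsOpenMap (Quot.mk _ : G × Rpos → MappingTorus g c) := by
  intro U hU
  rw [← isQuotientMap_quot_mk.isOpen_preimage]
  have : (Quot.mk (torusRel g c)) ⁻¹' (Quot.mk (torusRel g c) '' U) =
      ⋃ n : ℤ, (fun x : G × Rpos => (g ^ n * x.1, c ^ n * x.2)) ⁻¹' U := by
    ext x
    simp only [mem_preimage, mem_image, mem_iUnion]
    constructor
    · rintro ⟨y, hy, hyx⟩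
      obtain ⟨n, rfl⟩ := (MappingTorus.mk_eq_mk_iff g c x y).1 hyx.symm
      exact ⟨n, hy⟩
    · rintro ⟨n, hn⟩
      exact ⟨_, hn, ((MappingTorus.mk_eq_mk_iff g c _ _).2 ⟨n, rfl⟩).symm⟩
  rw [this]
  refine isOpen_iUnion fun n => hU.preimage ?_
  exact (continuous_of_discreteTopology.comp continuous_fst).prodMk
    ((continuous_rpos_mul_left _).comp continuous_snd)

theorem MappingTorus.isOpenMap_curve (h : G) : IsOpenMap (MappingTorus.curve g c h) := by
  refine (MappingTorus.isOpenMap_mk g c).comp fun U hU => ?_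
  have : (fun s : Rpos => (h, s)) '' U = {h} ×ˢ U := by
    rw [singleton_prod]
  rw [this]
  exact (isOpen_discrete _).prod hU

end Topology

end MappingTorus

section CommGroup

variable {G : Type*} [CommGroup G] (g : G) (c : Rpos)

/-- The map `[h, s] ↦ h⟨g⟩` indexing the connected components of the mapping torus. -/
def MappingTorus.coset : MappingTorus g c → G ⧸ Subgroup.zpowers g :=
  Quot.lift (fun x => QuotientGroup.mk x.1) (by
    rintro x y ⟨n, rfl⟩
    refine QuotientGroup.eq.2 ⟨n, ?_⟩
    simp [mul_comm])

theorem MappingTorus.range_curve (h : G) :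
    range (MappingTorus.curve g c h) = MappingTorus.coset g c ⁻¹' {QuotientGroup.mk h} := by
  ext ⟨k, s⟩
  constructor
  · rintro ⟨t, ht⟩
    rw [← ht]
    rfl
  · intro hk
    obtain ⟨n, hn⟩ := QuotientGroup.eq.1 (show (QuotientGroup.mk k : G ⧸ Subgroup.zpowers g) =
      QuotientGroup.mk h from hk)
    refine ⟨c ^ n * s, ((MappingTorus.mk_eq_mk_iff g c _ _).2 ⟨n, ?_⟩).symm⟩
    simp only at hn
    rw [hn]
    simp [mul_comm]

variable [TopologicalSpace G] [DiscreteTopology G]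

theorem MappingTorus.isClopen_preimage_coset (a : G ⧸ Subgroup.zpowers g) :
    IsClopen (MappingTorus.coset g c ⁻¹' {a}) := by
  let _ : TopologicalSpace (G ⧸ Subgroup.zpowers g) := ⊥
  have : DiscreteTopology (G ⧸ Subgroup.zpowers g) := ⟨rfl⟩
  refine (isClopen_discrete _).preimage (continuous_quot_lift _ ?_)
  exact continuous_of_discreteTopology.comp continuous_fst

theorem MappingTorus.connectedComponent_curve (h : G) (s : Rpos) :
    connectedComponent (MappingTorus.curve g c h s) = range (MappingTorus.curve g c h) := by
  apply Subset.antisymm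
  · rw [MappingTorus.range_curve]
    exact (MappingTorus.isClopen_preimage_coset g c _).connectedComponent_subset rfl
  · have : PreconnectedSpace Rpos :=
      isPreconnected_iff_preconnectedSpace.1 (isPreconnected_Ioi (a := (0 : ℝ)))
    exact (isPreconnected_range (MappingTorus.continuous_curve g c h)).subset_connectedComponent
      (mem_range_self s)

/-- The set of connected components of the mapping torus is `G ⧸ ⟨g⟩`. -/
theorem MappingTorus.card_connectedComponents :
    Nat.card (ConnectedComponents (MappingTorus g c)) = Nat.card (G ⧸ Subgroup.zpowers g) := by
  have key : ∀ x y : MappingTorus g c,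
      connectedComponent x = connectedComponent y ↔
        MappingTorus.coset g c x = MappingTorus.coset g c y := by
    rintro ⟨h, s⟩ ⟨k, t⟩
    change connectedComponent (MappingTorus.curve g c h s) =
      connectedComponent (MappingTorus.curve g c k t) ↔ _
    rw [connectedComponent_eq_iff_mem, MappingTorus.connectedComponent_curve,
      MappingTorus.range_curve]
    rfl
  refine Nat.card_eq_of_bijective
    (Quotient.lift (MappingTorus.coset g c) fun x y hxy => (key x y).1 hxy) ⟨?_, ?_⟩
  · rintro ⟨x⟩ ⟨y⟩ hxy
    exact Quotient.sound ((key x y).2 hxy)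
  · rintro ⟨h⟩
    exact ⟨Quotient.mk _ (Quot.mk _ (h, 1)), rfl⟩

/-- The component of `[h, s]` is the circle `ℝ₊/c^{fℤ}`, with `f` the order of `g`. -/
theorem MappingTorus.exists_homeomorph_connectedComponent (h : G) (s : Rpos) :
    ∃ e : (Rpos ⧸ Subgroup.zpowers (c ^ orderOf g)) ≃ₜ
        (connectedComponent (MappingTorus.curve g c h s) : Set (MappingTorus g c)),
      ∀ t : Rpos, (e (QuotientGroup.mk t) : MappingTorus g c) = MappingTorus.curve g c h t := by
  have hrange := MappingTorus.connectedComponent_curve g c h s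
  let u : Rpos → (connectedComponent (MappingTorus.curve g c h s) : Set (MappingTorus g c)) :=
    fun t => ⟨MappingTorus.curve g c h t, hrange ▸ mem_range_self t⟩
  have hu : Continuous u := (MappingTorus.continuous_curve g c h).subtype_mk _
  let v : (Rpos ⧸ Subgroup.zpowers (c ^ orderOf g)) →
      (connectedComponent (MappingTorus.curve g c h s) : Set (MappingTorus g c)) :=
    Quotient.lift u fun a b hab =>
      Subtype.ext ((MappingTorus.curve_eq_curve_iff h a b).2 (Quotient.sound hab))
  have hv : Continuous v := continuous_quot_lift _ hu
  have hinj : Function.Injective v := by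
    rintro ⟨a⟩ ⟨b⟩ hab
    exact (MappingTorus.curve_eq_curve_iff h a b).1 (congrArg Subtype.val hab)
  have hsurj : Function.Surjective v := by
    rintro ⟨y, hy⟩
    obtain ⟨t, rfl⟩ := hrange ▸ hy
    exact ⟨QuotientGroup.mk t, rfl⟩
  have huo : IsOpenMap u := fun U hU => by
    have : u '' U = Subtype.val ⁻¹' (MappingTorus.curve g c h '' U) := by
      ext y
      simp only [mem_image, mem_preimage, Subtype.ext_iff, u]
    rw [this]
    exact (MappingTorus.isOpenMap_curve g c h U hU).preimage continuous_subtype_val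
  have hvo : IsOpenMap v := fun U hU => by
    rw [← image_preimage_eq U QuotientGroup.mk_surjective, ← image_comp]
    exact huo _ (hU.preimage continuous_quotient_mk')
  exact ⟨(Equiv.ofBijective v ⟨hinj, hsurj⟩).toHomeomorphOfContinuousOpen hv hvo, fun t => rfl⟩

end CommGroup

/-- the mapping torus of multiplication by an element `g` of order `f` in a finite
abelian (discrete) group `G`, over the circle `ℝ₊/p^ℤ`, has exactly `r = |G|/f` connected
components, each of which is a circle `ℝ₊/p^{fℤ}`, the projection to `ℝ₊/p^ℤ` restricting on each
component to a cyclic covering of degree `f`. -/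
theorem statement8 {G : Type*} [CommGroup G] [Finite G] [TopologicalSpace G] [DiscreteTopology G]
    (g : G) (p : ℝ) (hp : 1 < p) (pp : Rpos) (hpp : (pp : ℝ) = p) :
    Nat.card (ConnectedComponents (MappingTorus g pp)) = Nat.card G / orderOf g ∧
    ∃ π : MappingTorus g pp → Rpos ⧸ Subgroup.zpowers pp,
      Continuous π ∧
      (∀ (h : G) (s : Rpos), π (Quot.mk _ (h, s)) = QuotientGroup.mk s) ∧
      ∀ x : MappingTorus g pp,
        ∃ e : (connectedComponent x : Set (MappingTorus g pp)) ≃ₜ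
            (Rpos ⧸ Subgroup.zpowers (pp ^ orderOf g)),
          ∀ s : Rpos,
            π ((e.symm (QuotientGroup.mk s) : connectedComponent x) : MappingTorus g pp) =
              QuotientGroup.mk s := by
  refine ⟨?_, MappingTorus.proj g pp, MappingTorus.continuous_proj g pp, fun _ _ => rfl, ?_⟩
  · rw [MappingTorus.card_connectedComponents, ← Nat.card_zpowers,
      Subgroup.card_eq_card_quotient_mul_card_subgroup (Subgroup.zpowers g),
      Nat.mul_div_cancel _ Nat.card_pos]
  · rintro ⟨h, s⟩
    obtain ⟨e, he⟩ := MappingTorus.exists_homeomorph_connectedComponent g pp h s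
    refine ⟨e.symm, fun t => ?_⟩
    exact congrArg (MappingTorus.proj g pp) (he t)
end
end

section
/- Let p be a prime and let 𝔓 be a maximal ideal of ℤ̄ containing p. Then the residue field k := ℤ̄/𝔓 is an algebraic closure of 𝔽_p, and the reduction map ℤ̄ → k restricts to a group isomorphism from μ_{(p)}, the group of roots of unity in ℚ̄ˣ whose order is prime to p, onto the multiplicative group kˣ. -/
noncomputable section

/-- An algebraic closure `ℚ̄` of `ℚ`. -/
abbrev Qbar : Type := AlgebraicClosure ℚ

/-- `ℤ̄`, the ring of all algebraic integers: the integral closure of `ℤ` in `ℚ̄`. -/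
abbrev Zbar : Type := integralClosure ℤ Qbar

/-- `μ_{(p)}`, the group of roots of unity (inside `ℤ̄ˣ`) of order prime to `p`. -/
def muPrimeTo (p : ℕ) (hp : p.Prime) : Subgroup Zbarˣ where
  carrier := {z | ∃ n : ℕ, 0 < n ∧ ¬p ∣ n ∧ z ^ n = 1}
  one_mem' := ⟨1, one_pos, fun h => hp.ne_one (Nat.dvd_one.mp h), one_pow 1⟩
  mul_mem' := by
    rintro a b ⟨n, hn, hpn, ha⟩ ⟨m, hm, hpm, hb⟩
    refine ⟨n * m, Nat.mul_pos hn hm, ?_, ?_⟩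
    · intro h
      rcases hp.dvd_mul.mp h with h' | h'
      exacts [hpn h', hpm h']
    · rw [mul_pow, pow_mul, ha, one_pow, one_mul, mul_comm n m, pow_mul, hb, one_pow]
  inv_mem' := by
    rintro a ⟨n, hn, hpn, ha⟩
    exact ⟨n, hn, hpn, by rw [inv_pow, ha, inv_one]⟩

noncomputable instance (P : Ideal Zbar) [P.IsMaximal] : Field (Zbar ⧸ P) :=
  Ideal.Quotient.field P

open Polynomial in
/-- A field that is a quotient of `ℤ̄` is algebraically closed: lift a monic polynomial to `ℤ̄`,
where it has a root. -/
theorem isAlgClosed_of_surjective_Zbar {k : Type*} [Field k] (f : Zbar →+* k)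
    (hf : Function.Surjective f) : IsAlgClosed k := by
  refine IsAlgClosed.of_exists_root k fun q hq hirr => ?_
  obtain ⟨g, hgmap, hgdeg, hg⟩ := lifts_and_degree_eq_and_monic (map_surjective f hf q) hq
  have hdeg : (g.map (algebraMap Zbar Qbar)).degree ≠ 0 := by
    rw [hg.degree_map, hgdeg]
    exact hirr.degree_pos.ne'
  obtain ⟨y, hy⟩ := IsAlgClosed.exists_root _ hdeg
  have hyint : IsIntegral Zbar y := ⟨g, hg, by rwa [IsRoot.def, eval_map] at hy⟩
  let z : Zbar := ⟨y, isIntegral_trans (R := ℤ) y hyint⟩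
  have hz : g.eval z = 0 := by
    apply FaithfulSMul.algebraMap_injective Zbar Qbar
    rw [map_zero, ← eval_map_apply]
    exact hy
  refine ⟨f z, ?_⟩
  rw [← hgmap, eval_map_apply, hz, map_zero]

/-- An element integral over `ℤ` of a field of characteristic `p` lies in a finite subfield. -/
theorem exists_pow_prime_pow_eq_self_of_isIntegral {k : Type*} [Field k] (p : ℕ)
    [Fact p.Prime] [CharP k p] {x : k} (hx : IsIntegral ℤ x) :
    ∃ n : ℕ, 0 < n ∧ x ^ p ^ n = x := by
  let := ZMod.algebra k p
  have hx' : IsIntegral (ZMod p) x := hx.tower_top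
  let F := IntermediateField.adjoin (ZMod p) {x}
  have : FiniteDimensional (ZMod p) F := IntermediateField.adjoin.finiteDimensional hx'
  have : Finite F := Module.finite_of_finite (ZMod p)
  have : Fintype F := Fintype.ofFinite F
  obtain ⟨n, -, hn⟩ := FiniteField.card F p
  refine ⟨n, n.pos, ?_⟩
  have h := FiniteField.pow_card (⟨x, IntermediateField.mem_adjoin_simple_self _ x⟩ : F)
  rw [hn] at h
  exact congrArg Subtype.val h

theorem exists_isPrimitiveRoot_Zbar (n : ℕ) (hn : 0 < n) : ∃ ζ : Zbar, IsPrimitiveRoot ζ n := by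
  have : NeZero n := ⟨hn.ne'⟩
  obtain ⟨ζ, hζ⟩ := HasEnoughRootsOfUnity.exists_primitiveRoot Qbar n
  refine ⟨⟨ζ, hζ.isIntegral hn⟩, ?_⟩
  exact IsPrimitiveRoot.of_map_of_injective (f := algebraMap Zbar Qbar) hζ
    (FaithfulSMul.algebraMap_injective Zbar Qbar)

open Polynomial in
/-- Roots of unity lift along ring homomorphisms from `ℤ̄` to a domain. -/
theorem exists_pow_eq_one_map_eq {k : Type*} [CommRing k] [IsDomain k] (f : Zbar →+* k) {n : ℕ}
    (hn : 0 < n) {x : k} (hx : x ^ n = 1) : ∃ z : Zbar, z ^ n = 1 ∧ f z = x := by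
  obtain ⟨ζ, hζ⟩ := exists_isPrimitiveRoot_Zbar n hn
  have h := congrArg (eval₂ f x) (X_pow_sub_one_eq_prod hn hζ)
  rw [eval₂_sub, eval₂_X_pow, eval₂_one, hx, sub_self, eval₂_finsetProd, eq_comm,
    Finset.prod_eq_zero_iff] at h
  obtain ⟨z, hz, hzx⟩ := h
  rw [eval₂_sub, eval₂_X, eval₂_C, sub_eq_zero] at hzx
  exact ⟨z, (mem_nthRootsFinset hn 1).mp hz, hzx.symm⟩

/-- A root of unity reducing to `1` is `1`, provided its order is nonzero in the target. -/
theorem eq_one_of_pow_eq_one_of_map_eq_one {R k : Type*} [CommRing R] [IsDomain R] [CommRing k]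
    (f : R →+* k) {n : ℕ} (hn : (n : k) ≠ 0) {z : R} (hz : z ^ n = 1) (hfz : f z = 1) :
    z = 1 := by
  by_contra hne
  have h := mul_geom_sum z n
  rw [hz, sub_self, mul_eq_zero, or_iff_right (sub_ne_zero.mpr hne)] at h
  apply hn
  simpa [hfz] using congrArg f h

theorem bijective_map_muPrimeTo {k : Type*} [Field k] (f : Zbar →+* k) (p : ℕ) (hp : p.Prime)
    [CharP k p] (hk : ∀ x : k, ∃ n : ℕ, 0 < n ∧ x ^ p ^ n = x) :
    Function.Bijective ((Units.map (f : Zbar →* k)).comp (muPrimeTo p hp).subtype) := by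
  constructor
  · rw [injective_iff_map_eq_one]
    rintro ⟨z, n, _, hpn, hz⟩ h
    apply Subtype.ext
    apply Units.ext
    refine eq_one_of_pow_eq_one_of_map_eq_one f (n := n) ?_ ?_ (congrArg Units.val h)
    · rwa [Ne, CharP.cast_eq_zero_iff k p]
    · simpa using congrArg Units.val hz
  · intro x
    obtain ⟨n, hn, hx⟩ := hk x
    have hlt : 1 < p ^ n := Nat.one_lt_pow hn.ne' hp.one_lt
    have hN : 0 < p ^ n - 1 := Nat.sub_pos_of_lt hlt
    have hx1 : (x : k) ^ (p ^ n - 1) = 1 := by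
      apply mul_right_cancel₀ x.ne_zero
      rw [← pow_succ, Nat.sub_add_cancel hlt.le, hx, one_mul]
    obtain ⟨z, hz, hzx⟩ := exists_pow_eq_one_map_eq f hN hx1
    refine ⟨⟨Units.ofPowEqOne z _ hz hN.ne', p ^ n - 1, hN, fun h => ?_,
      Units.pow_ofPowEqOne hz hN.ne'⟩, Units.ext hzx⟩
    exact hp.one_lt.ne' (Nat.dvd_one.mp
      ((Nat.dvd_sub_iff_right hlt.le (dvd_pow_self p hn.ne')).mp h))

/-- for a maximal ideal `𝔓` of `ℤ̄` containing the prime `p`, the residue field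
`k = ℤ̄/𝔓` is an algebraic closure of `𝔽_p` (it is algebraically closed, of characteristic `p`,
and every element lies in a finite subfield `𝔽_{p^n}`), and reduction mod `𝔓` restricts to a
group isomorphism `μ_{(p)} ≃ kˣ`. -/
theorem statement10 (p : ℕ) (hp : p.Prime) (P : Ideal Zbar) [P.IsMaximal]
    (hpP : ((p : Zbar)) ∈ P) :
    IsAlgClosed (Zbar ⧸ P) ∧ CharP (Zbar ⧸ P) p ∧
    (∀ x : Zbar ⧸ P, ∃ n : ℕ, 0 < n ∧ x ^ (p ^ n) = x) ∧
    ∃ e : muPrimeTo p hp ≃* (Zbar ⧸ P)ˣ,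
      ∀ z : muPrimeTo p hp,
        ((e z : (Zbar ⧸ P)ˣ) : Zbar ⧸ P) = Ideal.Quotient.mk P ((z : Zbarˣ) : Zbar) := by
  have : Fact p.Prime := ⟨hp⟩
  have hsurj : Function.Surjective (Ideal.Quotient.mk P) := Ideal.Quotient.mk_surjective
  have hchar : CharP (Zbar ⧸ P) p := by
    refine (CharP.charP_iff_prime_eq_zero hp).mpr ?_
    rw [← map_natCast (Ideal.Quotient.mk P), Ideal.Quotient.eq_zero_iff_mem]
    exact hpP
  have hfin : ∀ x : Zbar ⧸ P, ∃ n : ℕ, 0 < n ∧ x ^ p ^ n = x := fun x => by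
    obtain ⟨a, rfl⟩ := hsurj x
    refine exists_pow_prime_pow_eq_self_of_isIntegral p ?_
    exact (integralClosure.isIntegral a).map (Ideal.Quotient.mk P).toIntAlgHom
  refine ⟨isAlgClosed_of_surjective_Zbar (Ideal.Quotient.mk P) hsurj, hchar, hfin, ?_⟩
  exact ⟨MulEquiv.ofBijective _ (bijective_map_muPrimeTo (Ideal.Quotient.mk P) p hp hfin),
    fun z => rfl⟩
end
end
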